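/- Fix β ∈ (0,2]. For r > 0 and θ ∈ (0,π), define W(r) = 2(β−1) e^{2r} sinh r / (e^{4r} − (β−1)²) and H(r) = (1/4)(1 − coth r) · [ (β−1)²(1 − 3e^{2r}) − e^{6r}(1 − 3e^{−2r}) ] / (e^{4r} − (β−1)²), and consider the configuration Φ¹ = H, Φ² = Φ³ = 0, with gauge-potential components 𝒜¹_φ = (1/2) cos θ, 𝒜²_φ = W sin θ, 𝒜³_θ = −W, and all remaining components 𝒜¹_r = 𝒜¹_θ = 𝒜²_r = 𝒜²_θ = 𝒜³_r = 𝒜³_φ = 0. Then (Φᵃ, 𝒜ᵃ_μ) satisfies the Bogomolny equations: for each a = 1,2,3, D_rΦᵃ = −Fᵃ_{θφ}/(sinh²r sin θ), D_θΦᵃ = Fᵃ_{rφ}/sin θ, and D_φΦᵃ = −sin θ · Fᵃ_{rθ}. (For β = 2 this is the smooth charge-1 monopole with ‖Φ‖ = (1/2)tanh r; for β ∈ (0,2) it is a singular monopole of mass 1/2 and total charge −1.) -/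

import Mathlib

noncomputable section

/-- Partial derivative in the radial coordinate `r`. -/
def pdr (f : ℝ → ℝ → ℝ → ℝ) (r θ φ : ℝ) : ℝ := deriv (fun t => f t θ φ) r

/-- Partial derivative in the polar coordinate `θ`. -/
def pdθ (f : ℝ → ℝ → ℝ → ℝ) (r θ φ : ℝ) : ℝ := deriv (fun t => f r t φ) θ

/-- Partial derivative in the azimuthal coordinate `φ`. -/
def pdφ (f : ℝ → ℝ → ℝ → ℝ) (r θ φ : ℝ) : ℝ := deriv (fun t => f r θ t) φ

/-- The profile function `W(r) = 2(β−1)e^{2r} sinh r/(e^{4r} − (β−1)²)`. -/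
def Wfun (β r : ℝ) : ℝ :=
  2 * (β - 1) * Real.exp (2 * r) * Real.sinh r / (Real.exp (4 * r) - (β - 1) ^ 2)

/-- The Higgs profile
`H(r) = (1/4)(1 − coth r)[(β−1)²(1 − 3e^{2r}) − e^{6r}(1 − 3e^{−2r})]/(e^{4r} − (β−1)²)`. -/
def Hfun (β r : ℝ) : ℝ :=
  (1 / 4) * (1 - Real.cosh r / Real.sinh r)
    * (((β - 1) ^ 2 * (1 - 3 * Real.exp (2 * r))
        - Real.exp (6 * r) * (1 - 3 * Real.exp (-(2 * r))))
      / (Real.exp (4 * r) - (β - 1) ^ 2))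

/-- Components of the Einstein-family monopole. -/
def Phi1 (β : ℝ) : ℝ → ℝ → ℝ → ℝ := fun r _ _ => Hfun β r
def Phi2 (_ : ℝ) : ℝ → ℝ → ℝ → ℝ := fun _ _ _ => 0
def Phi3 (_ : ℝ) : ℝ → ℝ → ℝ → ℝ := fun _ _ _ => 0
def A1r (_ : ℝ) : ℝ → ℝ → ℝ → ℝ := fun _ _ _ => 0
def A1θ (_ : ℝ) : ℝ → ℝ → ℝ → ℝ := fun _ _ _ => 0
def A1φ (_ : ℝ) : ℝ → ℝ → ℝ → ℝ := fun _ θ _ => (1 / 2) * Real.cos θ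
def A2r (_ : ℝ) : ℝ → ℝ → ℝ → ℝ := fun _ _ _ => 0
def A2θ (_ : ℝ) : ℝ → ℝ → ℝ → ℝ := fun _ _ _ => 0
def A2φ (β : ℝ) : ℝ → ℝ → ℝ → ℝ := fun r θ _ => Wfun β r * Real.sin θ
def A3r (_ : ℝ) : ℝ → ℝ → ℝ → ℝ := fun _ _ _ => 0
def A3θ (β : ℝ) : ℝ → ℝ → ℝ → ℝ := fun r _ _ => -(Wfun β r)
def A3φ (_ : ℝ) : ℝ → ℝ → ℝ → ℝ := fun _ _ _ => 0

/-- Covariant derivatives `D_μΦᵃ = ∂_μΦᵃ + 2 ε_{abc}𝒜ᵇ_μΦᶜ`. -/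
def D1r (β r θ φ : ℝ) : ℝ :=
  pdr (Phi1 β) r θ φ + 2 * (A2r β r θ φ * Phi3 β r θ φ - A3r β r θ φ * Phi2 β r θ φ)
def D1θ (β r θ φ : ℝ) : ℝ :=
  pdθ (Phi1 β) r θ φ + 2 * (A2θ β r θ φ * Phi3 β r θ φ - A3θ β r θ φ * Phi2 β r θ φ)
def D1φ (β r θ φ : ℝ) : ℝ :=
  pdφ (Phi1 β) r θ φ + 2 * (A2φ β r θ φ * Phi3 β r θ φ - A3φ β r θ φ * Phi2 β r θ φ)
def D2r (β r θ φ : ℝ) : ℝ :=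
  pdr (Phi2 β) r θ φ + 2 * (A3r β r θ φ * Phi1 β r θ φ - A1r β r θ φ * Phi3 β r θ φ)
def D2θ (β r θ φ : ℝ) : ℝ :=
  pdθ (Phi2 β) r θ φ + 2 * (A3θ β r θ φ * Phi1 β r θ φ - A1θ β r θ φ * Phi3 β r θ φ)
def D2φ (β r θ φ : ℝ) : ℝ :=
  pdφ (Phi2 β) r θ φ + 2 * (A3φ β r θ φ * Phi1 β r θ φ - A1φ β r θ φ * Phi3 β r θ φ)
def D3r (β r θ φ : ℝ) : ℝ :=
  pdr (Phi3 β) r θ φ + 2 * (A1r β r θ φ * Phi2 β r θ φ - A2r β r θ φ * Phi1 β r θ φ)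
def D3θ (β r θ φ : ℝ) : ℝ :=
  pdθ (Phi3 β) r θ φ + 2 * (A1θ β r θ φ * Phi2 β r θ φ - A2θ β r θ φ * Phi1 β r θ φ)
def D3φ (β r θ φ : ℝ) : ℝ :=
  pdφ (Phi3 β) r θ φ + 2 * (A1φ β r θ φ * Phi2 β r θ φ - A2φ β r θ φ * Phi1 β r θ φ)

/-- Field strength components `Fᵃ_{μν} = ∂_μ𝒜ᵃ_ν − ∂_ν𝒜ᵃ_μ + 2 ε_{abc}𝒜ᵇ_μ𝒜ᶜ_ν`. -/
def F1θφ (β r θ φ : ℝ) : ℝ :=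
  pdθ (A1φ β) r θ φ - pdφ (A1θ β) r θ φ
    + 2 * (A2θ β r θ φ * A3φ β r θ φ - A3θ β r θ φ * A2φ β r θ φ)
def F1rφ (β r θ φ : ℝ) : ℝ :=
  pdr (A1φ β) r θ φ - pdφ (A1r β) r θ φ
    + 2 * (A2r β r θ φ * A3φ β r θ φ - A3r β r θ φ * A2φ β r θ φ)
def F1rθ (β r θ φ : ℝ) : ℝ :=
  pdr (A1θ β) r θ φ - pdθ (A1r β) r θ φ
    + 2 * (A2r β r θ φ * A3θ β r θ φ - A3r β r θ φ * A2θ β r θ φ)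
def F2θφ (β r θ φ : ℝ) : ℝ :=
  pdθ (A2φ β) r θ φ - pdφ (A2θ β) r θ φ
    + 2 * (A3θ β r θ φ * A1φ β r θ φ - A1θ β r θ φ * A3φ β r θ φ)
def F2rφ (β r θ φ : ℝ) : ℝ :=
  pdr (A2φ β) r θ φ - pdφ (A2r β) r θ φ
    + 2 * (A3r β r θ φ * A1φ β r θ φ - A1r β r θ φ * A3φ β r θ φ)
def F2rθ (β r θ φ : ℝ) : ℝ :=
  pdr (A2θ β) r θ φ - pdθ (A2r β) r θ φ
    + 2 * (A3r β r θ φ * A1θ β r θ φ - A1r β r θ φ * A3θ β r θ φ)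
def F3θφ (β r θ φ : ℝ) : ℝ :=
  pdθ (A3φ β) r θ φ - pdφ (A3θ β) r θ φ
    + 2 * (A1θ β r θ φ * A2φ β r θ φ - A2θ β r θ φ * A1φ β r θ φ)
def F3rφ (β r θ φ : ℝ) : ℝ :=
  pdr (A3φ β) r θ φ - pdφ (A3r β) r θ φ
    + 2 * (A1r β r θ φ * A2φ β r θ φ - A2r β r θ φ * A1φ β r θ φ)
def F3rθ (β r θ φ : ℝ) : ℝ :=
  pdr (A3θ β) r θ φ - pdθ (A3r β) r θ φ
    + 2 * (A1r β r θ φ * A2θ β r θ φ - A2r β r θ φ * A1θ β r θ φ)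

/-- The denominator `e^{4r} − (β−1)²` is positive for `r > 0` when `β ∈ (0,2]`. -/
theorem exp_four_sub_sq_pos {β r : ℝ} (hβ : β ∈ Set.Ioc (0 : ℝ) 2) (hr : 0 < r) :
    0 < Real.exp (4 * r) - (β - 1) ^ 2 := by
  have h1 : 1 < Real.exp (4 * r) := Real.one_lt_exp_iff.mpr (by linarith)
  nlinarith [hβ.1, hβ.2]

theorem sinh_eq_exp_form (r : ℝ) :
    Real.sinh r = (Real.exp r ^ 2 - 1) / (2 * Real.exp r) := by
  rw [Real.sinh_eq, Real.exp_neg]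
  field_simp

theorem cosh_eq_exp_form (r : ℝ) :
    Real.cosh r = (Real.exp r ^ 2 + 1) / (2 * Real.exp r) := by
  rw [Real.cosh_eq, Real.exp_neg]
  field_simp

theorem exp_two_mul (r : ℝ) : Real.exp (2 * r) = Real.exp r ^ 2 :=
  mod_cast Real.exp_nat_mul r 2

theorem exp_four_mul (r : ℝ) : Real.exp (4 * r) = Real.exp r ^ 4 :=
  mod_cast Real.exp_nat_mul r 4

theorem exp_six_mul (r : ℝ) : Real.exp (6 * r) = Real.exp r ^ 6 :=
  mod_cast Real.exp_nat_mul r 6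

/-- `H` as a rational function of `u = e^r`. -/
theorem Hfun_eq_rational (β : ℝ) {r : ℝ} (hr : 0 < r) :
    Hfun β r = -(1 / 2) * ((β - 1) ^ 2 * (1 - 3 * Real.exp r ^ 2)
        - Real.exp r ^ 6 + 3 * Real.exp r ^ 4)
      / ((Real.exp r ^ 2 - 1) * (Real.exp r ^ 4 - (β - 1) ^ 2)) := by
  have hu : 0 < Real.exp r := Real.exp_pos r
  have h2 : Real.exp r ^ 2 - 1 ≠ 0 := by
    nlinarith [Real.one_lt_exp_iff.mpr hr]
  simp only [Hfun, sinh_eq_exp_form, cosh_eq_exp_form, Real.exp_neg,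
    exp_two_mul, exp_four_mul, exp_six_mul]
  set u := Real.exp r
  have hcoth : 1 - (u ^ 2 + 1) / (2 * u) / ((u ^ 2 - 1) / (2 * u)) = -2 / (u ^ 2 - 1) := by
    field_simp
    ring
  have hnum : u ^ 6 * (1 - 3 * (u ^ 2)⁻¹) = u ^ 6 - 3 * u ^ 4 := by
    field_simp
  rw [hcoth, hnum]
  simp only [div_eq_mul_inv, mul_inv]
  ring

/-- The radial equation `dW/dr = −2WH`. -/
theorem hasDerivAt_Wfun {β r : ℝ} (hβ : β ∈ Set.Ioc (0 : ℝ) 2) (hr : 0 < r) :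
    HasDerivAt (Wfun β) (-2 * Wfun β r * Hfun β r) r := by
  have hD := (exp_four_sub_sq_pos hβ hr).ne'
  have he (c : ℝ) : HasDerivAt (fun t => Real.exp (c * t)) (Real.exp (c * r) * c) r := by
    simpa using ((hasDerivAt_id r).const_mul c).exp
  have hW := (((he 2).const_mul (2 * (β - 1))).mul (Real.hasDerivAt_sinh r)).div
    ((he 4).sub_const ((β - 1) ^ 2)) hD
  refine hW.congr_deriv ?_
  have hu : 0 < Real.exp r := Real.exp_pos r
  have h2 : Real.exp r ^ 2 - 1 ≠ 0 := by
    nlinarith [Real.one_lt_exp_iff.mpr hr]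
  rw [Hfun_eq_rational β hr]
  simp only [Wfun, Pi.mul_apply, sinh_eq_exp_form, cosh_eq_exp_form,
    exp_two_mul, exp_four_mul] at hD ⊢
  field_simp
  ring

/-- The radial equation `dH/dr = (1/2 − 2W²)/sinh² r`. -/
theorem hasDerivAt_Hfun {β r : ℝ} (hβ : β ∈ Set.Ioc (0 : ℝ) 2) (hr : 0 < r) :
    HasDerivAt (Hfun β) ((1 / 2 - 2 * Wfun β r ^ 2) / Real.sinh r ^ 2) r := by
  have hD := (exp_four_sub_sq_pos hβ hr).ne'
  have hu : 0 < Real.exp r := Real.exp_pos r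
  have h2 : Real.exp r ^ 2 - 1 ≠ 0 := by
    nlinarith [Real.one_lt_exp_iff.mpr hr]
  simp only [exp_four_mul] at hD
  have hp (n : ℕ) := (Real.hasDerivAt_exp r).pow n
  have hH := (((((((hp 2).const_mul 3).const_sub 1).const_mul ((β - 1) ^ 2)).sub (hp 6)).add
      ((hp 4).const_mul 3)).const_mul (-(1 / 2))).div
    (((hp 2).sub_const 1).mul ((hp 4).sub_const ((β - 1) ^ 2))) (mul_ne_zero h2 hD)
  refine (hH.congr_of_eventuallyEq ?_).congr_deriv ?_
  · filter_upwards [lt_mem_nhds hr] with t ht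
    exact Hfun_eq_rational β ht
  · simp only [Wfun, Pi.mul_apply, Pi.sub_apply, Pi.add_apply, Pi.pow_apply,
      sinh_eq_exp_form, exp_two_mul, exp_four_mul]
    field_simp
    ring

/-- The Einstein-family configuration `(Φᵃ, 𝒜ᵃ_μ)`, obtained by projecting the spin
connection of the conformally Einstein hyperbolic Gibbons–Hawking metric onto
`su(2)⁺`, satisfies the Bogomolny equations on hyperbolic 3-space. -/
theorem einstein_family_bogomolny (β : ℝ) (hβ : β ∈ Set.Ioc (0 : ℝ) 2) :
    ∀ r θ φ : ℝ, 0 < r → θ ∈ Set.Ioo 0 Real.pi →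
      (D1r β r θ φ = -(F1θφ β r θ φ) / (Real.sinh r ^ 2 * Real.sin θ) ∧
       D1θ β r θ φ = F1rφ β r θ φ / Real.sin θ ∧
       D1φ β r θ φ = -(Real.sin θ) * F1rθ β r θ φ) ∧
      (D2r β r θ φ = -(F2θφ β r θ φ) / (Real.sinh r ^ 2 * Real.sin θ) ∧
       D2θ β r θ φ = F2rφ β r θ φ / Real.sin θ ∧
       D2φ β r θ φ = -(Real.sin θ) * F2rθ β r θ φ) ∧
      (D3r β r θ φ = -(F3θφ β r θ φ) / (Real.sinh r ^ 2 * Real.sin θ) ∧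
       D3θ β r θ φ = F3rφ β r θ φ / Real.sin θ ∧
       D3φ β r θ φ = -(Real.sin θ) * F3rθ β r θ φ) := by
  intro r θ φ hr hθ
  have hs : Real.sin θ ≠ 0 := (Real.sin_pos_of_mem_Ioo hθ).ne'
  have hsinh : Real.sinh r ≠ 0 := (Real.sinh_pos_iff.mpr hr).ne'
  have hWθ : deriv (fun t => Wfun β t * Real.sin θ) r = _ :=
    ((hasDerivAt_Wfun hβ hr).mul_const (Real.sin θ)).deriv
  have hWn : deriv (fun t => -Wfun β t) r = _ := (hasDerivAt_Wfun hβ hr).neg.deriv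
  have hH : deriv (fun t => Hfun β t) r = _ := (hasDerivAt_Hfun hβ hr).deriv
  have hcos : deriv (fun t => 1 / 2 * Real.cos t) θ = _ :=
    ((Real.hasDerivAt_cos θ).const_mul (1 / 2)).deriv
  have hsin : deriv (fun t => Wfun β r * Real.sin t) θ = _ :=
    ((Real.hasDerivAt_sin θ).const_mul (Wfun β r)).deriv
  simp only [D1r, D1θ, D1φ, D2r, D2θ, D2φ, D3r, D3θ, D3φ, F1θφ, F1rφ, F1rθ, F2θφ, F2rφ, F2rθ,
    F3θφ, F3rφ, F3rθ, pdr, pdθ, pdφ, Phi1, Phi2, Phi3, A1r, A1θ, A1φ, A2r, A2θ, A2φ, A3r, A3θ, A3φ,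
    hWθ, hWn, hH, hcos, hsin, deriv_const]
  refine ⟨⟨?_, ?_, ?_⟩, ⟨?_, ?_, ?_⟩, ?_, ?_, ?_⟩ <;> field_simp <;> ring
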